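/- Let 0 < α < 1. There exists a constant c_α > 0, depending only on α, with the following property. Set i = ⌈1/α⌉ and define K : [0,∞) → ℝ by K(s) = (1 − s^{i−1})/(1 − s) + exp(c_α s^i)·( s^{i−1} + (s^i − s^{2i−1})/(α(1 − s)) ) for s ≠ 1, and K(1) = (i − 1) + exp(c_α)·(1 + (i − 1)/α). Then for every T > 0, every β₀ ≥ 0, every nonnegative function y integrable on (0,T), and every nonnegative measurable function b on (0,T] such that y(t) ≤ b(t) + β₀ ∫₀ᵗ (t − s)^{α−1} y(s) ds for all t ∈ (0,T], one has y(t) ≤ b(t) + c_α β₀ K(β₀ T^α) ∫₀ᵗ (t − s)^{α−1} b(s) ds for all t ∈ (0,T]. -/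

import Mathlib

open MeasureTheory Set
open scoped ENNReal

/-- The kernel of the Riemann-Liouville fractional integral of order `p` on `(0, ∞)`, without
the normalising factor `1 / Γ(p)`. -/
noncomputable def rlKernel (p t s : ℝ) : ℝ≥0∞ :=
  if 0 < s ∧ s < t then ENNReal.ofReal ((t - s) ^ (p - 1)) else 0

/-- The Riemann-Liouville fractional integral of order `p`, without the normalising factor
`1 / Γ(p)`. -/
noncomputable def rlIntegral (p : ℝ) (f : ℝ → ℝ≥0∞) (t : ℝ) : ℝ≥0∞ :=
  ∫⁻ s, rlKernel p t s * f s

theorem measurable_rlKernel (p : ℝ) : Measurable (Function.uncurry (rlKernel p)) := by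
  unfold rlKernel
  refine Measurable.ite ?_ (by fun_prop) measurable_const
  exact (measurableSet_lt measurable_const measurable_snd).inter
    (measurableSet_lt measurable_snd measurable_fst)

theorem measurable_rlKernel_right (p t : ℝ) : Measurable (rlKernel p t) :=
  (measurable_rlKernel p).of_uncurry_left

theorem measurable_rlIntegral (p : ℝ) {f : ℝ → ℝ≥0∞} (hf : Measurable f) :
    Measurable (rlIntegral p f) :=
  Measurable.lintegral_prod_right' (f := fun z : ℝ × ℝ => rlKernel p z.1 z.2 * f z.2)
    ((measurable_rlKernel p).mul (hf.comp measurable_snd))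

theorem rlIntegral_eq_setLIntegral (p : ℝ) (f : ℝ → ℝ≥0∞) (t : ℝ) :
    rlIntegral p f t = ∫⁻ s in Ioo 0 t, ENNReal.ofReal ((t - s) ^ (p - 1)) * f s := by
  rw [← lintegral_indicator measurableSet_Ioo]
  refine lintegral_congr fun s => ?_
  by_cases h : 0 < s ∧ s < t <;> simp [rlKernel, indicator, h]

theorem rlIntegral_one (f : ℝ → ℝ≥0∞) (t : ℝ) :
    rlIntegral 1 f t = ∫⁻ s in Ioo 0 t, f s := by
  simp [rlIntegral_eq_setLIntegral]

theorem rlIntegral_mono (p : ℝ) {f g : ℝ → ℝ≥0∞} {t : ℝ} (h : ∀ s ∈ Ioo 0 t, f s ≤ g s) :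
    rlIntegral p f t ≤ rlIntegral p g t := by
  simp only [rlIntegral_eq_setLIntegral]
  exact setLIntegral_mono' measurableSet_Ioo fun s hs => mul_le_mul_right (h s hs) _

theorem rlIntegral_add (p : ℝ) {f : ℝ → ℝ≥0∞} (hf : Measurable f) (g : ℝ → ℝ≥0∞) (t : ℝ) :
    rlIntegral p (fun s => f s + g s) t = rlIntegral p f t + rlIntegral p g t := by
  simp only [rlIntegral, mul_add]
  exact lintegral_add_left ((measurable_rlKernel_right p t).mul hf) _

theorem rlIntegral_const_mul (p : ℝ) {f : ℝ → ℝ≥0∞} (hf : Measurable f) (c : ℝ≥0∞) (t : ℝ) :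
    rlIntegral p (fun s => c * f s) t = c * rlIntegral p f t := by
  simp only [rlIntegral, mul_left_comm _ c]
  exact lintegral_const_mul _ ((measurable_rlKernel_right p t).mul hf)

theorem rlIntegral_sum (p : ℝ) {ι : Type*} (I : Finset ι) {f : ι → ℝ → ℝ≥0∞}
    (hf : ∀ i, Measurable (f i)) (t : ℝ) :
    rlIntegral p (fun s => ∑ i ∈ I, f i s) t = ∑ i ∈ I, rlIntegral p (f i) t := by
  simp only [rlIntegral, Finset.mul_sum]
  exact lintegral_finsetSum _ fun i _ => (measurable_rlKernel_right p t).mul (hf i)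

theorem rlIntegral_le_of_order_le {p q : ℝ} (hpq : p ≤ q) {T t : ℝ} (htT : t ≤ T)
    (f : ℝ → ℝ≥0∞) :
    rlIntegral q f t ≤ ENNReal.ofReal (T ^ (q - p)) * rlIntegral p f t := by
  simp only [rlIntegral_eq_setLIntegral]
  rw [← lintegral_const_mul' _ _ ENNReal.ofReal_ne_top]
  refine setLIntegral_mono' measurableSet_Ioo fun s hs => ?_
  have hs' : 0 < t - s := sub_pos.2 hs.2
  rw [← mul_assoc, ← ENNReal.ofReal_mul (Real.rpow_nonneg (by linarith [hs.1]) _)]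
  gcongr
  rw [show q - 1 = (q - p) + (p - 1) by ring, Real.rpow_add hs']
  gcongr
  linarith [hs.1]

theorem setLIntegral_sub_left_rpow {p : ℝ} (hp : 0 < p) {u t : ℝ} (hut : u ≤ t) :
    ∫⁻ s in Ioo u t, ENNReal.ofReal ((s - u) ^ (p - 1)) = ENNReal.ofReal ((t - u) ^ p / p) := by
  have hint : IntervalIntegrable (fun s => (s - u) ^ (p - 1)) volume u t := by
    simpa using (intervalIntegral.intervalIntegrable_rpow' (a := 0) (b := t - u)
      (show -1 < p - 1 by linarith)).comp_sub_right u
  rw [← ofReal_integral_eq_lintegral_ofReal]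
  · rw [← integral_Ioc_eq_integral_Ioo, ← intervalIntegral.integral_of_le hut,
      intervalIntegral.integral_comp_sub_right (fun x => x ^ (p - 1)),
      integral_rpow (Or.inl (by linarith))]
    simp [Real.zero_rpow hp.ne']
  · exact ((intervalIntegrable_iff_integrableOn_Ioc_of_le hut).1 hint).mono_set Ioo_subset_Ioc_self
  · filter_upwards [ae_restrict_mem measurableSet_Ioo] with s hs
    exact Real.rpow_nonneg (by linarith [hs.1]) _

theorem setLIntegral_sub_right_rpow {p : ℝ} (hp : 0 < p) {u t : ℝ} (hut : u ≤ t) :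
    ∫⁻ s in Ioo u t, ENNReal.ofReal ((t - s) ^ (p - 1)) = ENNReal.ofReal ((t - u) ^ p / p) := by
  have h := (Measure.measurePreserving_sub_left volume (t + u)).setLIntegral_comp_preimage_emb
    (MeasurableEquiv.subLeft (t + u)).measurableEmbedding
    (fun s => ENNReal.ofReal ((s - u) ^ (p - 1))) (Ioo u t)
  rw [setLIntegral_sub_left_rpow hp hut] at h
  rw [← h]
  simp only [preimage_const_sub_Ioo, add_sub_cancel_left, add_sub_cancel_right]
  refine lintegral_congr fun s => ?_
  congr 2
  ring

theorem rpow_sub_one_le_two_mul {p x L : ℝ} (hp : 0 < p) (hx : L / 2 ≤ x) (hxL : x ≤ L)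
    (hL : 0 < L) : x ^ (p - 1) ≤ 2 * L ^ (p - 1) := by
  have hLp : 0 < L ^ (p - 1) := Real.rpow_pos_of_pos hL _
  rcases le_total 1 p with h | h
  · have : x ^ (p - 1) ≤ L ^ (p - 1) :=
      Real.rpow_le_rpow (by linarith) hxL (by linarith)
    linarith
  · calc x ^ (p - 1) ≤ (L / 2) ^ (p - 1) :=
          Real.rpow_le_rpow_of_nonpos (by linarith) hx (by linarith)
      _ = 2 ^ (1 - p) * L ^ (p - 1) := by
          rw [Real.div_rpow hL.le zero_le_two, show 1 - p = -(p - 1) by ring,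
            Real.rpow_neg zero_le_two]
          field_simp
      _ ≤ 2 ^ (1 : ℝ) * L ^ (p - 1) := by
          gcongr
          · norm_num
          · linarith
      _ = 2 * L ^ (p - 1) := by rw [Real.rpow_one]

theorem lintegral_rlKernel_mul_rlKernel_le {p q : ℝ} (hp : 0 < p) (hq : 0 < q) (t u : ℝ) :
    ∫⁻ s, rlKernel p t s * rlKernel q s u
      ≤ ENNReal.ofReal (2 * (1 / p + 1 / q)) * rlKernel (p + q) t u := by
  by_cases hu : 0 < u ∧ u < t
  · have hL : 0 < t - u := sub_pos.2 hu.2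
    have hLp := Real.rpow_nonneg hL.le (p - 1)
    have hLq := Real.rpow_nonneg hL.le (q - 1)
    calc ∫⁻ s, rlKernel p t s * rlKernel q s u
        ≤ ∫⁻ s in Ioo u t,
            (ENNReal.ofReal (2 * (t - u) ^ (q - 1)) * ENNReal.ofReal ((t - s) ^ (p - 1))
            + ENNReal.ofReal (2 * (t - u) ^ (p - 1)) * ENNReal.ofReal ((s - u) ^ (q - 1))) := by
          rw [← lintegral_indicator measurableSet_Ioo]
          refine lintegral_mono fun s => ?_
          by_cases hs : s ∈ Ioo u t
          · have hts : 0 < t - s := sub_pos.2 hs.2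
            have hsu : 0 < s - u := sub_pos.2 hs.1
            have h1 := Real.rpow_nonneg hts.le (p - 1)
            have h2 := Real.rpow_nonneg hsu.le (q - 1)
            rw [indicator_of_mem hs, rlKernel, rlKernel, if_pos ⟨hu.1.trans hs.1, hs.2⟩,
              if_pos ⟨hu.1, hs.1⟩, ← ENNReal.ofReal_mul h1, ← ENNReal.ofReal_mul (by positivity),
              ← ENNReal.ofReal_mul (by positivity),
              ← ENNReal.ofReal_add (by positivity) (by positivity)]
            apply ENNReal.ofReal_le_ofReal
            rcases le_total (s - u) (t - s) with h | h
            · have := rpow_sub_one_le_two_mul (x := t - s) hp (by linarith)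
                (by linarith : t - s ≤ t - u) hL
              nlinarith [mul_le_mul_of_nonneg_right this h2, mul_nonneg hLq h1]
            · have := rpow_sub_one_le_two_mul (x := s - u) hq (by linarith)
                (by linarith : s - u ≤ t - u) hL
              nlinarith [mul_le_mul_of_nonneg_right this h1, mul_nonneg hLp h2]
          · rw [indicator_of_notMem hs, rlKernel, rlKernel]
            by_cases h : s < t
            · have : ¬ u < s := fun h' => hs ⟨h', h⟩
              simp [this]
            · simp [h]
      _ = ENNReal.ofReal (2 * (1 / p + 1 / q)) * rlKernel (p + q) t u := by
          rw [lintegral_add_left (by fun_prop), lintegral_const_mul _ (by fun_prop),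
            lintegral_const_mul _ (by fun_prop), setLIntegral_sub_right_rpow hp hu.2.le,
            setLIntegral_sub_left_rpow hq hu.2.le, rlKernel, if_pos hu,
            ← ENNReal.ofReal_mul (by positivity), ← ENNReal.ofReal_mul (by positivity),
            ← ENNReal.ofReal_mul (by positivity),
            ← ENNReal.ofReal_add (by positivity) (by positivity)]
          congr 1
          rw [show p + q - 1 = p + (q - 1) by ring, Real.rpow_add hL, Real.rpow_sub_one hL.ne',
            Real.rpow_sub_one hL.ne']
          field_simp
  · refine (lintegral_eq_zero_of_ae_eq_zero (.of_forall fun s => ?_)).trans_le zero_le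
    by_cases h : 0 < u
    · have htu : t ≤ u := not_lt.1 fun h' => hu ⟨h, h'⟩
      by_cases hst : s < t
      · simp [rlKernel, not_lt.2 (hst.le.trans htu)]
      · simp [rlKernel, hst]
    · simp [rlKernel, h]

theorem rlIntegral_rlIntegral_le {p q : ℝ} (hp : 0 < p) (hq : 0 < q) {f : ℝ → ℝ≥0∞}
    (hf : Measurable f) (t : ℝ) :
    rlIntegral p (rlIntegral q f) t
      ≤ ENNReal.ofReal (2 * (1 / p + 1 / q)) * rlIntegral (p + q) f t := by
  have hq_meas := measurable_rlKernel q
  have hp_meas := measurable_rlKernel_right p t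
  have hqf (s : ℝ) : Measurable fun u => rlKernel q s u * f u :=
    (measurable_rlKernel_right q s).mul hf
  have hpq (u : ℝ) : Measurable fun s => rlKernel p t s * rlKernel q s u :=
    hp_meas.mul hq_meas.of_uncurry_right
  calc rlIntegral p (rlIntegral q f) t
      = ∫⁻ s, ∫⁻ u, rlKernel p t s * (rlKernel q s u * f u) := by
        refine lintegral_congr fun s => ?_
        rw [lintegral_const_mul _ (hqf s), rlIntegral]
    _ = ∫⁻ u, ∫⁻ s, rlKernel p t s * (rlKernel q s u * f u) := by
        refine lintegral_lintegral_swap (Measurable.aemeasurable ?_)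
        exact (hp_meas.comp measurable_fst).mul (hq_meas.mul (hf.comp measurable_snd))
    _ ≤ ∫⁻ u, ENNReal.ofReal (2 * (1 / p + 1 / q)) * (rlKernel (p + q) t u * f u) := by
        refine lintegral_mono fun u => ?_
        simp only [← mul_assoc]
        rw [lintegral_mul_const _ (hpq u)]
        exact mul_le_mul_left (lintegral_rlKernel_mul_rlKernel_le hp hq t u) _
    _ = _ := lintegral_const_mul _ ((measurable_rlKernel_right _ t).mul hf)

theorem le_sum_rlIntegral_add_of_le {α β C T : ℝ} (hα : 0 < α) (hβ : 0 ≤ β) (hC : 4 / α ≤ C)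
    {y b : ℝ → ℝ≥0∞} (hy : Measurable y) (hb : Measurable b)
    (h : ∀ t ∈ Ioc 0 T, y t ≤ b t + ENNReal.ofReal β * rlIntegral α y t) (n : ℕ) :
    ∀ t ∈ Ioc 0 T, y t ≤ b t
      + ∑ k ∈ Finset.range n, ENNReal.ofReal (β ^ (k + 1) * C ^ k) * rlIntegral ((k + 1) * α) b t
      + ENNReal.ofReal (β ^ (n + 1) * C ^ n) * rlIntegral ((n + 1) * α) y t := by
  have hC0 : 0 ≤ C := le_trans (by positivity) hC
  induction n with
  | zero => simpa using h
  | succ n ih =>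
    intro t ht
    refine (ih t ht).trans ?_
    have hn : 0 < ((n : ℝ) + 1) * α := by positivity
    have hconst : 2 * (1 / ((n + 1) * α) + 1 / α) ≤ C := by
      have : 1 / ((n + 1) * α) ≤ 1 / α :=
        one_div_le_one_div_of_le hα (by nlinarith [(Nat.cast_nonneg n : (0 : ℝ) ≤ n)])
      have : 4 / α = 4 * (1 / α) := by ring
      linarith
    have hstep : rlIntegral ((n + 1) * α) y t ≤ rlIntegral ((n + 1) * α) b t
        + ENNReal.ofReal (β * C) * rlIntegral ((n + 1 + 1) * α) y t := by
      refine (rlIntegral_mono _ fun s hs => h s ⟨hs.1, hs.2.le.trans ht.2⟩).trans ?_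
      rw [rlIntegral_add _ hb, rlIntegral_const_mul _ (measurable_rlIntegral α hy),
        ENNReal.ofReal_mul hβ, mul_assoc]
      gcongr
      refine (rlIntegral_rlIntegral_le hn hα hy t).trans ?_
      rw [show (n + 1) * α + α = ((n : ℝ) + 1 + 1) * α by ring]
      gcongr
    rw [Finset.sum_range_succ, add_assoc, add_assoc, add_assoc]
    gcongr
    refine (mul_le_mul_right hstep _).trans_eq ?_
    rw [mul_add, ← mul_assoc, ← ENNReal.ofReal_mul (by positivity)]
    push_cast
    congr 3
    ring_nf

theorem setLIntegral_exp_le {c : ℝ} (hc : 0 < c) {t : ℝ} (ht : 0 ≤ t) :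
    ∫⁻ s in Ioo 0 t, ENNReal.ofReal (Real.exp (c * s)) ≤ ENNReal.ofReal (Real.exp (c * t) / c) := by
  have hcont : Continuous fun s => Real.exp (c * s) := by fun_prop
  rw [← ofReal_integral_eq_lintegral_ofReal
    ((hcont.integrableOn_Icc (a := 0) (b := t)).mono_set Ioo_subset_Icc_self)
    (.of_forall fun s => (Real.exp_pos _).le)]
  apply ENNReal.ofReal_le_ofReal
  rw [← integral_Ioc_eq_integral_Ioo, ← intervalIntegral.integral_of_le ht,
    intervalIntegral.integral_comp_mul_left _ hc.ne', integral_exp]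
  simp only [mul_zero, Real.exp_zero, smul_eq_mul]
  rw [div_eq_inv_mul]
  gcongr
  linarith

/-- A Gronwall inequality in integrated form, with non-optimal constants. -/
theorem rlIntegral_one_le_of_le_add {M T : ℝ} (hM : 0 ≤ M) {y B : ℝ → ℝ≥0∞}
    (hB : Measurable B) (hyT : rlIntegral 1 y T < ∞)
    (h : ∀ t ∈ Ioc 0 T, y t ≤ B t + ENNReal.ofReal M * rlIntegral 1 y t) {t : ℝ}
    (ht : t ∈ Ioc 0 T) :
    rlIntegral 1 y t ≤ ENNReal.ofReal (2 * Real.exp (2 * M * t)) * rlIntegral 1 B t := by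
  have hmono (f : ℝ → ℝ≥0∞) : Monotone (rlIntegral 1 f) := fun r s hrs => by
    simp only [rlIntegral_one]
    exact lintegral_mono_set (Ioo_subset_Ioo_right hrs)
  have hY (r : ℝ) (hr : r ∈ Ioc 0 t) : rlIntegral 1 y r ≤
      rlIntegral 1 B t + ENNReal.ofReal M * rlIntegral 1 (rlIntegral 1 y) r := by
    refine (rlIntegral_mono 1 fun s hs => h s ⟨hs.1, hs.2.le.trans (hr.2.trans ht.2)⟩).trans ?_
    rw [rlIntegral_add _ hB, rlIntegral_const_mul _ (hmono y).measurable]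
    gcongr
    exact hmono B hr.2
  rcases hM.eq_or_lt with rfl | hM
  · refine (hY t ⟨ht.1, le_rfl⟩).trans ?_
    simp only [ENNReal.ofReal_zero, zero_mul, add_zero, mul_zero, Real.exp_zero, mul_one]
    exact le_mul_of_one_le_left zero_le (by simp)
  set S : ℝ≥0∞ := ⨆ r ∈ Ioc 0 t, ENNReal.ofReal (Real.exp (-(2 * M * r))) * rlIntegral 1 y r
  have hexp (r : ℝ) : ENNReal.ofReal (Real.exp (2 * M * r))
      * ENNReal.ofReal (Real.exp (-(2 * M * r))) = 1 := by
    rw [← ENNReal.ofReal_mul (Real.exp_pos _).le, ← Real.exp_add]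
    simp
  have hexp_le (r : ℝ) (hr : 0 < r) : ENNReal.ofReal (Real.exp (-(2 * M * r))) ≤ 1 := by
    rw [ENNReal.ofReal_le_one, Real.exp_le_one_iff]
    have : 0 < 2 * M * r := by positivity
    linarith
  have hYS (r : ℝ) (hr : r ∈ Ioc 0 t) :
      rlIntegral 1 y r ≤ ENNReal.ofReal (Real.exp (2 * M * r)) * S := by
    rw [← one_mul (rlIntegral 1 y r), ← hexp r, mul_assoc]
    gcongr
    exact le_iSup₂_of_le r hr le_rfl
  have hS_top : S ≠ ∞ := by
    refine ((iSup₂_le fun r hr => ?_).trans_lt hyT).ne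
    exact (mul_le_of_le_one_left zero_le (hexp_le r hr.1)).trans (hmono y (hr.2.trans ht.2))
  have hS_half : S ≤ rlIntegral 1 B t + ENNReal.ofReal (1 / 2) * S := by
    refine iSup₂_le fun r hr => ?_
    have hII : rlIntegral 1 (rlIntegral 1 y) r
        ≤ ENNReal.ofReal (Real.exp (2 * M * r) / (2 * M)) * S := by
      rw [rlIntegral_one]
      calc _ ≤ ∫⁻ s in Ioo 0 r, ENNReal.ofReal (Real.exp (2 * M * s)) * S :=
            setLIntegral_mono' measurableSet_Ioo fun s hs => hYS s ⟨hs.1, hs.2.le.trans hr.2⟩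
        _ = (∫⁻ s in Ioo 0 r, ENNReal.ofReal (Real.exp (2 * M * s))) * S :=
            lintegral_mul_const _ (by fun_prop)
        _ ≤ _ := mul_le_mul_left (setLIntegral_exp_le (by positivity) hr.1.le) _
    calc ENNReal.ofReal (Real.exp (-(2 * M * r))) * rlIntegral 1 y r
        ≤ ENNReal.ofReal (Real.exp (-(2 * M * r))) * (rlIntegral 1 B t + ENNReal.ofReal M
            * (ENNReal.ofReal (Real.exp (2 * M * r) / (2 * M)) * S)) := by
          gcongr
          exact (hY r hr).trans (by gcongr)
      _ ≤ rlIntegral 1 B t + ENNReal.ofReal (1 / 2) * S := by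
          rw [mul_add]
          refine add_le_add (mul_le_of_le_one_left zero_le (hexp_le r hr.1)) (le_of_eq ?_)
          rw [← mul_assoc, ← mul_assoc, ← ENNReal.ofReal_mul (Real.exp_pos _).le,
            ← ENNReal.ofReal_mul (by positivity)]
          congr 2
          rw [Real.exp_neg]
          field_simp
  have hS_le : S ≤ 2 * rlIntegral 1 B t := by
    rcases eq_or_ne (rlIntegral 1 B t) ∞ with hD | hD
    · simp [hD]
    · lift rlIntegral 1 B t to NNReal using hD with D
      lift S to NNReal using hS_top with S'
      rw [show ENNReal.ofReal (1 / 2) = ((1 / 2 : NNReal) : ℝ≥0∞) by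
        rw [← ENNReal.ofReal_coe_nnreal]; simp] at hS_half
      norm_cast at hS_half ⊢
      rw [← NNReal.coe_le_coe] at hS_half ⊢
      push_cast at hS_half ⊢
      linarith
  calc rlIntegral 1 y t ≤ ENNReal.ofReal (Real.exp (2 * M * t)) * S := hYS t ⟨ht.1, le_rfl⟩
    _ ≤ ENNReal.ofReal (Real.exp (2 * M * t)) * (2 * rlIntegral 1 B t) := by gcongr
    _ = _ := by
      rw [ENNReal.ofReal_mul zero_le_two, ENNReal.ofReal_ofNat]
      ring

/-- The singular Gronwall inequality with an explicit constant; `n + 1` iterations make the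
kernel bounded. -/
theorem le_add_rlIntegral_of_le {α β C T : ℝ} (hα : 0 < α) (hα1 : α ≤ 1) (hβ : 0 ≤ β)
    (hC : 4 / α ≤ C) {y b : ℝ → ℝ≥0∞} (hy : Measurable y) (hb : Measurable b)
    (hyT : rlIntegral 1 y T < ∞)
    (h : ∀ t ∈ Ioc 0 T, y t ≤ b t + ENNReal.ofReal β * rlIntegral α y t) {n : ℕ}
    (hn : 1 ≤ (n + 1) * α) {t : ℝ} (ht : t ∈ Ioc 0 T) :
    y t ≤ b t + ENNReal.ofReal (β * (∑ k ∈ Finset.range n, (C * (β * T ^ α)) ^ k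
        + 2 * Real.exp (2 * (C ^ n * (β * T ^ α) ^ (n + 1))) * ((C * (β * T ^ α)) ^ n
          + (C * (β * T ^ α)) ^ (n + 1) * ∑ k ∈ Finset.range n, (C * (β * T ^ α)) ^ k)))
      * rlIntegral α b t := by
  have hT : 0 < T := ht.1.trans_le ht.2
  have hC0 : 0 ≤ C := le_trans (by positivity) hC
  have hpow (k : ℕ) : (T ^ α) ^ k = T ^ (k * α) := by
    rw [mul_comm, Real.rpow_mul_natCast hT.le]
  set M : ℝ := β ^ (n + 1) * C ^ n * T ^ ((n + 1) * α - 1) with hM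
  have hM0 : 0 ≤ M := by positivity
  have hTM : M * T = C ^ n * (β * T ^ α) ^ (n + 1) := by
    rw [hM, mul_pow, hpow, Real.rpow_sub_one hT.ne']
    push_cast
    field_simp
  set B : ℝ → ℝ≥0∞ := fun t => b t
    + ∑ k ∈ Finset.range n, ENNReal.ofReal (β ^ (k + 1) * C ^ k) * rlIntegral ((k + 1) * α) b t
    with hB
  have hterm (k : ℕ) : Measurable fun t =>
      ENNReal.ofReal (β ^ (k + 1) * C ^ k) * rlIntegral ((k + 1) * α) b t :=
    (measurable_rlIntegral _ hb).const_mul _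
  have hB_meas : Measurable B := hb.add (Finset.measurable_fun_sum _ fun k _ => hterm k)
  have hyB : ∀ t ∈ Ioc 0 T, y t ≤ B t + ENNReal.ofReal M * rlIntegral 1 y t := by
    intro t ht
    refine (le_sum_rlIntegral_add_of_le hα hβ hC hy hb h n t ht).trans ?_
    rw [hM, ENNReal.ofReal_mul (by positivity : 0 ≤ β ^ (n + 1) * C ^ n), mul_assoc]
    gcongr
    exact rlIntegral_le_of_order_le hn ht.2 y
  have hBt : B t ≤ b t + ENNReal.ofReal (β * ∑ k ∈ Finset.range n, (C * (β * T ^ α)) ^ k)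
      * rlIntegral α b t := by
    rw [hB, Finset.mul_sum, ENNReal.ofReal_sum_of_nonneg fun k _ => by positivity,
      Finset.sum_mul]
    refine add_le_add le_rfl (Finset.sum_le_sum fun k _ => ?_)
    refine (mul_le_mul_right (rlIntegral_le_of_order_le (p := α) ?_ ht.2 b) _).trans_eq ?_
    · nlinarith [(Nat.cast_nonneg k : (0 : ℝ) ≤ k)]
    rw [← mul_assoc, ← ENNReal.ofReal_mul (by positivity)]
    congr 2
    rw [mul_pow, mul_pow, hpow, show (k + 1) * α - α = k * α by ring]
    ring
  have hIB : rlIntegral 1 B t ≤ ENNReal.ofReal (T ^ (1 - α)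
      * (1 + C * (β * T ^ α) * ∑ k ∈ Finset.range n, (C * (β * T ^ α)) ^ k))
      * rlIntegral α b t := by
    rw [hB, rlIntegral_add _ hb, rlIntegral_sum _ _ hterm, mul_add, mul_one,
      ENNReal.ofReal_add (by positivity) (by positivity), add_mul, Finset.mul_sum, Finset.mul_sum,
      ENNReal.ofReal_sum_of_nonneg fun k _ => by positivity, Finset.sum_mul]
    refine add_le_add (rlIntegral_le_of_order_le hα1 ht.2 b) (Finset.sum_le_sum fun k _ => ?_)
    have hk : 0 < ((k : ℝ) + 1) * α := by positivity
    have hkα : α ≤ (k + 1) * α := by nlinarith [(Nat.cast_nonneg k : (0 : ℝ) ≤ k)]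
    have hconst : 2 * (1 / 1 + 1 / ((k + 1) * α)) ≤ C := by
      have h1 : 1 / ((k + 1) * α) ≤ 1 / α := one_div_le_one_div_of_le hα hkα
      have h2 : 1 / 1 ≤ 1 / α := one_div_le_one_div_of_le hα hα1
      have h3 : 4 / α = 4 * (1 / α) := by ring
      linarith
    rw [rlIntegral_const_mul _ (measurable_rlIntegral _ hb)]
    calc _ ≤ ENNReal.ofReal (β ^ (k + 1) * C ^ k) * (ENNReal.ofReal C
          * (ENNReal.ofReal (T ^ (1 + (k + 1) * α - α)) * rlIntegral α b t)) := by
          gcongr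
          refine (rlIntegral_rlIntegral_le one_pos hk hb t).trans ?_
          gcongr
          exact rlIntegral_le_of_order_le (by linarith) ht.2 b
      _ = _ := by
          rw [← mul_assoc, ← mul_assoc, ← ENNReal.ofReal_mul (by positivity),
            ← ENNReal.ofReal_mul (by positivity)]
          congr 2
          rw [show 1 + (k + 1) * α - α = (1 - α) + ((k + 1 : ℕ) : ℝ) * α by push_cast; ring,
            Real.rpow_add hT, ← hpow]
          ring
  have hMT : M * T ^ (1 - α) = β * (C * (β * T ^ α)) ^ n := by
    rw [hM, mul_assoc, ← Real.rpow_add hT, mul_pow, mul_pow, hpow,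
      show (n + 1) * α - 1 + (1 - α) = n * α by ring]
    ring
  set G : ℝ := ∑ k ∈ Finset.range n, (C * (β * T ^ α)) ^ k
  have hG0 : 0 ≤ G := Finset.sum_nonneg fun k _ => by positivity
  have hexp : Real.exp (2 * M * t) ≤ Real.exp (2 * (C ^ n * (β * T ^ α) ^ (n + 1))) := by
    rw [← hTM, mul_assoc]
    gcongr
    exact ht.2
  calc y t ≤ B t + ENNReal.ofReal M * rlIntegral 1 y t := hyB t ht
    _ ≤ (b t + ENNReal.ofReal (β * G) * rlIntegral α b t) + ENNReal.ofReal M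
        * (ENNReal.ofReal (2 * Real.exp (2 * (C ^ n * (β * T ^ α) ^ (n + 1))))
          * (ENNReal.ofReal (T ^ (1 - α) * (1 + C * (β * T ^ α) * G)) * rlIntegral α b t)) := by
      gcongr
      refine (rlIntegral_one_le_of_le_add hM0 hB_meas hyT hyB ht).trans ?_
      gcongr
    _ = _ := by
      rw [← mul_assoc, ← mul_assoc, ← ENNReal.ofReal_mul hM0, ← ENNReal.ofReal_mul (by positivity),
        add_assoc, ← add_mul, ← ENNReal.ofReal_add (by positivity) (by positivity)]
      congr 3
      linear_combination 2 * Real.exp (2 * (C ^ n * (β * T ^ α) ^ (n + 1)))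
        * (1 + C * (β * T ^ α) * G) * hMT

/-- Generalized Gronwall inequality with weakly singular kernel (paper Lemma 2.2):
there is a constant `c_α` depending only on `α` such that, with `i = ⌈1/α⌉` and `K`
given by the explicit formula, any nonnegative `y` integrable on `(0,T)` satisfying
`y(t) ≤ b(t) + β₀ ∫₀ᵗ (t-s)^{α-1} y(s) ds` on `(0,T]` also satisfies
`y(t) ≤ b(t) + c_α β₀ K(β₀ T^α) ∫₀ᵗ (t-s)^{α-1} b(s) ds` on `(0,T]`. -/
theorem stmt_0 (α : ℝ) (hα0 : 0 < α) (hα1 : α < 1) :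
    ∃ c_α : ℝ, 0 < c_α ∧
      ∀ K : ℝ → ℝ,
        (∀ s : ℝ, 0 ≤ s → s ≠ 1 →
          K s = (1 - s ^ (⌈1 / α⌉₊ - 1)) / (1 - s)
            + Real.exp (c_α * s ^ ⌈1 / α⌉₊)
              * (s ^ (⌈1 / α⌉₊ - 1)
                + (s ^ ⌈1 / α⌉₊ - s ^ (2 * ⌈1 / α⌉₊ - 1)) / (α * (1 - s)))) →
        K 1 = ((⌈1 / α⌉₊ : ℝ) - 1) + Real.exp c_α * (1 + ((⌈1 / α⌉₊ : ℝ) - 1) / α) →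
        ∀ T : ℝ, 0 < T → ∀ β₀ : ℝ, 0 ≤ β₀ →
          ∀ y b : ℝ → ℝ≥0∞, Measurable y → Measurable b →
            (∫⁻ s in Ioo (0 : ℝ) T, y s) < ∞ →
            (∀ t ∈ Ioc (0 : ℝ) T,
              y t ≤ b t + ENNReal.ofReal β₀
                * ∫⁻ s in Ioo (0 : ℝ) t, ENNReal.ofReal ((t - s) ^ (α - 1)) * y s) →
            ∀ t ∈ Ioc (0 : ℝ) T,
              y t ≤ b t + ENNReal.ofReal (c_α * β₀ * K (β₀ * T ^ α))
                * ∫⁻ s in Ioo (0 : ℝ) t, ENNReal.ofReal ((t - s) ^ (α - 1)) * b s := by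
  obtain ⟨n, hn⟩ : ∃ n, ⌈1 / α⌉₊ = n + 1 :=
    Nat.exists_eq_succ_of_ne_zero (Nat.ceil_pos.2 (by positivity)).ne'
  have hnα : 1 ≤ ((n : ℝ) + 1) * α := by
    have := Nat.le_ceil (1 / α)
    rw [hn, div_le_iff₀ hα0] at this
    exact_mod_cast this
  have hα_inv : 1 ≤ 1 / α := by
    rw [le_div_iff₀ hα0]
    linarith
  set C : ℝ := 4 / α with hC
  have hC1 : 1 ≤ C := by
    rw [hC, le_div_iff₀ hα0]
    linarith
  refine ⟨2 * C ^ (2 * n + 1), by positivity, ?_⟩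
  rw [hn]
  intro K hK hK1 T hT β hβ y b hy hb hyT h t ht
  have hKs (s : ℝ) (hs : 0 ≤ s) : K s = ∑ k ∈ Finset.range n, s ^ k
      + Real.exp (2 * C ^ (2 * n + 1) * s ^ (n + 1))
        * (s ^ n + s ^ (n + 1) * (∑ k ∈ Finset.range n, s ^ k) / α) := by
    rcases eq_or_ne s 1 with rfl | hs1
    · simp [hK1]
    · rw [hK s hs hs1, geom_sum_eq hs1, show 2 * (n + 1) - 1 = n + 1 + n by omega,
        Nat.add_sub_cancel]
      have h1 : 1 - s ≠ 0 := sub_ne_zero.2 hs1.symm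
      have h2 : s - 1 ≠ 0 := sub_ne_zero.2 hs1
      rw [← neg_sub 1 (s ^ n), ← neg_sub 1 s, neg_div_neg_eq]
      congr 3
      field_simp
      ring
  simp only [← rlIntegral_eq_setLIntegral] at h ⊢
  rw [← rlIntegral_one] at hyT
  refine (le_add_rlIntegral_of_le hα0 hα1.le hβ hC.ge hy hb hyT h hnα ht).trans ?_
  gcongr b t + ENNReal.ofReal ?_ * _
  rw [mul_comm _ β, mul_assoc β]
  refine mul_le_mul_of_nonneg_left ?_ hβ
  have hs : 0 ≤ β * T ^ α := by positivity
  rw [hKs _ hs]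
  generalize β * T ^ α = s at hs
  have hsum : ∑ k ∈ Finset.range n, (C * s) ^ k ≤ C ^ n * ∑ k ∈ Finset.range n, s ^ k := by
    rw [Finset.mul_sum]
    refine Finset.sum_le_sum fun k hk => ?_
    rw [mul_pow]
    gcongr
    exact (Finset.mem_range.1 hk).le
  set G := ∑ k ∈ Finset.range n, s ^ k
  have hG : 0 ≤ G := Finset.sum_nonneg fun k _ => by positivity
  have hCn : C ^ n ≤ C ^ (2 * n + 1) := pow_le_pow_right₀ hC1 (by omega)
  rw [mul_add (2 * C ^ (2 * n + 1))]
  refine add_le_add ?_ ?_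
  · refine hsum.trans (mul_le_mul_of_nonneg_right ?_ hG)
    linarith [pow_pos (one_pos.trans_le hC1) n]
  · calc 2 * Real.exp (2 * (C ^ n * s ^ (n + 1)))
          * ((C * s) ^ n + (C * s) ^ (n + 1) * ∑ k ∈ Finset.range n, (C * s) ^ k)
        ≤ 2 * Real.exp (2 * (C ^ (2 * n + 1) * s ^ (n + 1)))
          * (C ^ (2 * n + 1) * s ^ n + (C * s) ^ (n + 1) * (C ^ n * (G * (1 / α)))) := by
          rw [mul_pow C s n]
          gcongr
          exact hsum.trans (by gcongr; exact le_mul_of_one_le_right hG hα_inv)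
      _ = _ := by
          ring_nf
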